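/- For all integers n, m ≥ 4, the P_6-chromatic number of the n×m grid graph satisfies s_6(P_n □ P_m) = 4. -/

import Mathlib

open SimpleGraph

/-- `f` is a `P_k`-coloring of `G`: a proper vertex coloring such that no path on `k`
vertices is bicolored, i.e. every path on `k` vertices receives at least 3 distinct colors. -/
def IsPkColoring {V α : Type*} [DecidableEq α] (G : SimpleGraph V) (k : ℕ) (f : V → α) : Prop :=
  (∀ u w : V, G.Adj u w → f u ≠ f w) ∧
  ∀ (u w : V) (p : G.Walk u w), p.IsPath → p.length + 1 = k →
    3 ≤ (p.support.map f).toFinset.card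

/-- The `P_k`-chromatic number: the least number of colors of a `P_k`-coloring. -/
noncomputable def pkChrom {V : Type*} (G : SimpleGraph V) (k : ℕ) : ℕ :=
  sInf {n : ℕ | ∃ f : V → Fin n, IsPkColoring G k f}

/-- Six colors alternate between the first two of them. -/
abbrev Alternates {α : Type*} (a b c d e g : α) : Prop :=
  c = a ∧ d = b ∧ e = a ∧ g = b

/-- The six vertices, in this order, form a walk in `G`. -/
abbrev IsChain6 {V : Type*} (G : SimpleGraph V) (a b c d e g : V) : Prop :=
  G.Adj a b ∧ G.Adj b c ∧ G.Adj c d ∧ G.Adj d e ∧ G.Adj e g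

lemma IsPkColoring.not_alternates {V α : Type*} [DecidableEq α] {G : SimpleGraph V} {f : V → α}
    (hf : IsPkColoring G 6 f) (a b c d e g : V) (hadj : IsChain6 G a b c d e g)
    (hnd : [a, b, c, d, e, g].Nodup) :
    ¬ Alternates (f a) (f b) (f c) (f d) (f e) (f g) := by
  rintro ⟨hc, hd, he, hg⟩
  obtain ⟨h1, h2, h3, h4, h5⟩ := hadj
  have h := hf.2 a g (.cons h1 (.cons h2 (.cons h3 (.cons h4 (.cons h5 .nil)))))
    ((Walk.isPath_def _).2 (by simpa using hnd)) (by simp)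
  have hsub : ([a, b, c, d, e, g].map f).toFinset ⊆ {f a, f b} := by
    intro y
    simp only [List.map_cons, List.map_nil, hc, hd, he, hg]
    simp
  have h' := (Finset.card_le_card hsub).trans Finset.card_le_two
  simp only [Walk.support_cons, Walk.support_nil] at h
  omega

/-- A proper coloring without alternating nonbacktracking walks on six vertices is a
`P_6`-coloring. -/
lemma isPkColoring_six_of_not_alternates {V α : Type*} [DecidableEq α] {G : SimpleGraph V}
    {f : V → α} (hadj : ∀ u w, G.Adj u w → f u ≠ f w)
    (halt : ∀ a b c d e g, IsChain6 G a b c d e g → a ≠ c → b ≠ d → c ≠ e → d ≠ g →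
      ¬ Alternates (f a) (f b) (f c) (f d) (f e) (f g)) : IsPkColoring G 6 f := by
  refine ⟨hadj, fun u w p hp hlen => ?_⟩
  match p, hp, hlen with
  | .cons (v := b) h1 (.cons (v := c) h2 (.cons (v := d) h3 (.cons (v := e) h4
      (.cons (v := g) h5 .nil)))), hp, _ =>
    have hnd := (Walk.isPath_def _).1 hp
    simp only [Walk.support_cons, Walk.support_nil, List.nodup_cons, List.mem_cons,
      not_or] at hnd
    by_contra hcard
    have hpair : ({f u, f b} : Finset α).card = 2 := Finset.card_pair (hadj _ _ h1)
    have hsub : ({f u, f b} : Finset α) ⊆ ([u, b, c, d, e, g].map f).toFinset := by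
      intro y
      simp
      tauto
    have heq := Finset.eq_of_subset_of_card_le hsub (by
      simp only [Walk.support_cons, Walk.support_nil] at hcard
      omega)
    have hmem : ∀ v ∈ [u, b, c, d, e, g], f v = f u ∨ f v = f b := fun v hv => by
      have : f v ∈ ([u, b, c, d, e, g].map f).toFinset :=
        List.mem_toFinset.2 (List.mem_map_of_mem hv)
      rw [← heq] at this
      simpa using this
    have hc := hmem c (by simp)
    have hd := hmem d (by simp)
    have he := hmem e (by simp)
    have hg := hmem g (by simp)
    have n2 := hadj _ _ h2
    have n3 := hadj _ _ h3
    have n4 := hadj _ _ h4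
    have n5 := hadj _ _ h5
    refine halt u b c d e g ⟨h1, h2, h3, h4, h5⟩ (by tauto) (by tauto) (by tauto) (by tauto) ?_
    grind

lemma IsPkColoring.comp_injective_hom {V W α : Type*} [DecidableEq α] {G : SimpleGraph V}
    {H : SimpleGraph W} {k : ℕ} {f : W → α} (hf : IsPkColoring H k f) (φ : G →g H)
    (hφ : Function.Injective φ) : IsPkColoring G k (f ∘ φ) := by
  refine ⟨fun u w h => hf.1 _ _ (φ.map_adj h), fun u w p hp hlen => ?_⟩
  have h := hf.2 _ _ (p.map φ) (hp.map hφ) (by simpa using hlen)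
  simpa using h

lemma IsPkColoring.injective_comp {V α β : Type*} [DecidableEq α] [DecidableEq β]
    {G : SimpleGraph V} {k : ℕ} {f : V → α} (hf : IsPkColoring G k f) {g : α → β}
    (hg : Function.Injective g) : IsPkColoring G k (g ∘ f) := by
  refine ⟨fun u w h e => hf.1 _ _ h (hg e), fun u w p hp hlen => ?_⟩
  have himage : ((p.support.map f).map g).toFinset = (p.support.map f).toFinset.image g := by
    ext
    simp
  rw [← List.map_map, himage, Finset.card_image_of_injective _ hg]
  exact hf.2 u w p hp hlen

instance (n m : ℕ) : DecidableRel ((pathGraph n).boxProd (pathGraph m)).Adj := fun u v =>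
  decidable_of_iff (((u.1.val + 1 = v.1.val ∨ v.1.val + 1 = u.1.val) ∧ u.2 = v.2) ∨
    ((u.2.val + 1 = v.2.val ∨ v.2.val + 1 = u.2.val) ∧ u.1 = v.1)) (by
      simp only [boxProd_adj, pathGraph_adj])

/-- The inclusion of the `4 × 4` grid as a corner of a larger grid. -/
def gridCornerHom {n m : ℕ} (hn : 4 ≤ n) (hm : 4 ≤ m) :
    (pathGraph 4).boxProd (pathGraph 4) →g (pathGraph n).boxProd (pathGraph m) where
  toFun v := (Fin.castLE hn v.1, Fin.castLE hm v.2)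
  map_rel' {u v} h := by
    simpa [boxProd_adj, pathGraph_adj, Fin.ext_iff] using h

lemma gridCornerHom_injective {n m : ℕ} (hn : 4 ≤ n) (hm : 4 ≤ m) :
    Function.Injective (gridCornerHom hn hm) := by
  rintro ⟨a, b⟩ ⟨c, d⟩ h
  simpa [gridCornerHom] using h

set_option synthInstance.maxHeartbeats 400000 in
set_option synthInstance.maxSize 4096 in
/-- Every proper 3-coloring of the `4 × 4` grid, read row by row, alternates along one of
eighteen paths. -/
lemma three_coloring_grid_four_four_alternates :
    ∀ a : Fin 3,
    ∀ b : Fin 3, a ≠ b →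
    ∀ c : Fin 3, b ≠ c →
    ∀ d : Fin 3, c ≠ d →
    ∀ e : Fin 3, a ≠ e →
    ∀ f : Fin 3, e ≠ f → b ≠ f →
    ∀ g : Fin 3, f ≠ g → c ≠ g →
    ∀ h : Fin 3, g ≠ h → d ≠ h → ¬ Alternates e f b c g h → ¬ Alternates e f b c d h →
    ∀ i : Fin 3, e ≠ i → ¬ Alternates d h g f e i →
    ∀ j : Fin 3, i ≠ j → f ≠ j → ¬ Alternates d c g f j i →
    ∀ k : Fin 3, j ≠ k → g ≠ k → ¬ Alternates e i j k g h → ¬ Alternates b f j k g h →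
    ∀ l : Fin 3, k ≠ l → h ≠ l → ¬ Alternates a b f g k l → ¬ Alternates e f j k l h →
      ¬ Alternates a b c g h l → ¬ Alternates a e f g h l → ¬ Alternates c b f j k l →
      ¬ Alternates a b c g k l →
    ∀ m : Fin 3, i ≠ m →
    ∀ n : Fin 3, m ≠ n → j ≠ n → ¬ Alternates h g k j n m → ¬ Alternates b f e i j n →
    ∀ o : Fin 3, n ≠ o → k ≠ o → ¬ Alternates a b f j n o → ¬ Alternates a e f g k o →
      ¬ Alternates d c g k o n →
    ∀ p : Fin 3, o ≠ p → l ≠ p → ¬ Alternates d c g k l p → False := by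
  decide +kernel

lemma not_isPkColoring_grid_four_four (x : Fin 4 × Fin 4 → Fin 3) :
    ¬ IsPkColoring ((pathGraph 4).boxProd (pathGraph 4)) 6 x := by
  intro hx
  have adj := hx.1
  have path (a b c d e g) (h : IsChain6 _ a b c d e g ∧ [a, b, c, d, e, g].Nodup) :=
    hx.not_alternates a b c d e g h.1 h.2
  exact three_coloring_grid_four_four_alternates
    (x (0, 0))
    (x (0, 1)) (adj _ _ (by decide))
    (x (0, 2)) (adj _ _ (by decide))
    (x (0, 3)) (adj _ _ (by decide))
    (x (1, 0)) (adj _ _ (by decide))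
    (x (1, 1)) (adj _ _ (by decide)) (adj _ _ (by decide))
    (x (1, 2)) (adj _ _ (by decide)) (adj _ _ (by decide))
    (x (1, 3)) (adj _ _ (by decide)) (adj _ _ (by decide)) (path _ _ _ _ _ _ (by decide))
      (path _ _ _ _ _ _ (by decide))
    (x (2, 0)) (adj _ _ (by decide)) (path _ _ _ _ _ _ (by decide))
    (x (2, 1)) (adj _ _ (by decide)) (adj _ _ (by decide)) (path _ _ _ _ _ _ (by decide))
    (x (2, 2)) (adj _ _ (by decide)) (adj _ _ (by decide)) (path _ _ _ _ _ _ (by decide))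
      (path _ _ _ _ _ _ (by decide))
    (x (2, 3)) (adj _ _ (by decide)) (adj _ _ (by decide)) (path _ _ _ _ _ _ (by decide))
      (path _ _ _ _ _ _ (by decide)) (path _ _ _ _ _ _ (by decide))
      (path _ _ _ _ _ _ (by decide)) (path _ _ _ _ _ _ (by decide))
      (path _ _ _ _ _ _ (by decide))
    (x (3, 0)) (adj _ _ (by decide))
    (x (3, 1)) (adj _ _ (by decide)) (adj _ _ (by decide)) (path _ _ _ _ _ _ (by decide))
      (path _ _ _ _ _ _ (by decide))
    (x (3, 2)) (adj _ _ (by decide)) (adj _ _ (by decide)) (path _ _ _ _ _ _ (by decide))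
      (path _ _ _ _ _ _ (by decide)) (path _ _ _ _ _ _ (by decide))
    (x (3, 3)) (adj _ _ (by decide)) (adj _ _ (by decide)) (path _ _ _ _ _ _ (by decide))

/-- A coloring of the circulant graph on `ZMod 8` with steps `±1`, `±2`. -/
def circulantColor : ZMod 8 → Fin 4 :=
  ![0, 1, 2, 0, 3, 1, 2, 3]

/-- Adjacency in the circulant graph on `ZMod 8` with steps `±1`, `±2`. -/
abbrev CirculantAdj (a b : ZMod 8) : Prop :=
  b = a + 1 ∨ b = a - 1 ∨ b = a + 2 ∨ b = a - 2

lemma circulantColor_ne : ∀ a b, CirculantAdj a b → circulantColor a ≠ circulantColor b := by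
  decide +kernel

set_option synthInstance.maxHeartbeats 400000 in
set_option synthInstance.maxSize 4096 in
lemma circulantColor_not_alternates : ∀ a b, CirculantAdj a b →
    ∀ c, CirculantAdj b c → a ≠ c → circulantColor c = circulantColor a →
    ∀ d, CirculantAdj c d → b ≠ d → circulantColor d = circulantColor b →
    ∀ e, CirculantAdj d e → c ≠ e → circulantColor e = circulantColor a →
    ∀ g, CirculantAdj e g → d ≠ g → circulantColor g ≠ circulantColor b := by
  decide +kernel

/-- The projection of a grid to `ZMod 8`; it is a locally injective homomorphism to the
circulant graph. -/
def gridToCirculant {n m : ℕ} (v : Fin n × Fin m) : ZMod 8 :=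
  ((v.1 + 2 * v.2 : ℤ) : ZMod 8)

lemma circulantAdj_gridToCirculant {n m : ℕ} {u v : Fin n × Fin m}
    (h : ((pathGraph n).boxProd (pathGraph m)).Adj u v) :
    CirculantAdj (gridToCirculant u) (gridToCirculant v) := by
  have key : (v.1 + 2 * v.2 : ℤ) = (u.1 + 2 * u.2) + 1 ∨
      (v.1 + 2 * v.2 : ℤ) = (u.1 + 2 * u.2) - 1 ∨
      (v.1 + 2 * v.2 : ℤ) = (u.1 + 2 * u.2) + 2 ∨
      (v.1 + 2 * v.2 : ℤ) = (u.1 + 2 * u.2) - 2 := by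
    simp only [boxProd_adj, pathGraph_adj, Fin.ext_iff] at h
    omega
  unfold gridToCirculant
  rcases key with h | h | h | h <;> rw [h] <;> simp [CirculantAdj]

lemma gridToCirculant_ne {n m : ℕ} {u v w : Fin n × Fin m}
    (huv : ((pathGraph n).boxProd (pathGraph m)).Adj u v)
    (hvw : ((pathGraph n).boxProd (pathGraph m)).Adj v w) (huw : u ≠ w) :
    gridToCirculant u ≠ gridToCirculant w := by
  intro h
  have h8 := (ZMod.intCast_eq_intCast_iff_dvd_sub _ _ 8).1 h
  simp only [boxProd_adj, pathGraph_adj, Fin.ext_iff] at huv hvw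
  simp only [ne_eq, Prod.ext_iff, Fin.ext_iff] at huw
  push_cast at h8
  omega

lemma isPkColoring_grid (n m : ℕ) : IsPkColoring ((pathGraph n).boxProd (pathGraph m)) 6
    (circulantColor ∘ gridToCirculant) := by
  refine isPkColoring_six_of_not_alternates
    (fun u w h => circulantColor_ne _ _ (circulantAdj_gridToCirculant h)) ?_
  rintro a b c d e g ⟨h1, h2, h3, h4, h5⟩ hac hbd hce hdg ⟨hc, hd, he, hg⟩
  exact circulantColor_not_alternates _ _ (circulantAdj_gridToCirculant h1)
    _ (circulantAdj_gridToCirculant h2) (gridToCirculant_ne h1 h2 hac) hc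
    _ (circulantAdj_gridToCirculant h3) (gridToCirculant_ne h2 h3 hbd) hd
    _ (circulantAdj_gridToCirculant h4) (gridToCirculant_ne h3 h4 hce) he
    _ (circulantAdj_gridToCirculant h5) (gridToCirculant_ne h4 h5 hdg) hg

theorem s6_grid (n m : ℕ) (hn : 4 ≤ n) (hm : 4 ≤ m) :
    pkChrom ((pathGraph n).boxProd (pathGraph m)) 6 = 4 := by
  have hmem : 4 ∈ {k : ℕ | ∃ f : Fin n × Fin m → Fin k,
      IsPkColoring ((pathGraph n).boxProd (pathGraph m)) 6 f} := ⟨_, isPkColoring_grid n m⟩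
  refine le_antisymm (Nat.sInf_le hmem) (le_csInf ⟨4, hmem⟩ ?_)
  rintro k ⟨f, hf⟩
  by_contra! hk
  exact not_isPkColoring_grid_four_four _
    ((hf.comp_injective_hom _ (gridCornerHom_injective hn hm)).injective_comp
      (Fin.castLE_injective (Nat.le_of_lt_succ hk)))
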